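/- Let σ ∈ Σ_n be the decreasing permutation, σ(j) = n+1−j for all j. Then every flag g in F^n with minlabel(g) = σ is a maximal flag (necessarily with label σ); that is, X_σ consists exactly of the maximal flags with label σ. -/

import Mathlib

open Matrix

variable {n : ℕ} {F : Type} [Field F]

/-- `(r, j)` is a pivot position of `M`: the entry `M r j` is nonzero and all entries of
column `j` strictly below row `r` vanish (i.e. `r` is the largest row index with `M r j ≠ 0`). -/
def IsPivot (M : Matrix (Fin n) (Fin n) F) (r j : Fin n) : Prop :=
  M r j ≠ 0 ∧ ∀ r' : Fin n, r < r' → M r' j = 0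

/-- The span of the first `j` columns of `M` (columns with index `< j` in 0-based indexing). -/
def colSpan (M : Matrix (Fin n) (Fin n) F) (j : ℕ) : Submodule F (Fin n → F) :=
  Submodule.span F ((fun i : Fin n => Mᵀ i) '' {i : Fin n | (i : ℕ) < j})

/-- A flag: a nonempty finite set of proper nonzero subspaces of `F^n` forming a chain. -/
def IsFlag (g : Set (Submodule F (Fin n → F))) : Prop :=
  g.Finite ∧ g.Nonempty ∧ IsChain (· ≤ ·) g ∧ ∀ V ∈ g, V ≠ ⊥ ∧ V ≠ ⊤

/-- A maximal flag: a flag containing a subspace of every dimension `1,…,n-1`. -/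
def IsMaximalFlag (f : Set (Submodule F (Fin n → F))) : Prop :=
  IsFlag f ∧ ∀ j : ℕ, 1 ≤ j → j ≤ n - 1 → ∃ V ∈ f, Module.finrank F V = j

/-- Conditions (i)–(iii) for a matrix representation of a flag `f`:
(i) for every `V ∈ f` the first `dim V` columns of `M` span `V`, and all `n` columns span `F^n`;
(ii) every pivot entry equals `1`;
(iii) entries in the same row as a pivot and strictly to its right vanish. -/
def IsRep (f : Set (Submodule F (Fin n → F))) (M : Matrix (Fin n) (Fin n) F) : Prop :=
  (∀ V ∈ f, colSpan M (Module.finrank F V) = V) ∧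
  colSpan M n = ⊤ ∧
  (∀ r j : Fin n, IsPivot M r j → M r j = 1) ∧
  (∀ r j j' : Fin n, IsPivot M r j → j < j' → M r j' = 0)

/-- Columns `i` and `i'` lie in the same block of the block decomposition induced by the
flag `g` (blocks are the intervals of columns between consecutive dimensions of members of `g`). -/
def SameBlock (g : Set (Submodule F (Fin n → F))) (i i' : Fin n) : Prop :=
  ∀ V ∈ g, ((i : ℕ) < Module.finrank F V ↔ (i' : ℕ) < Module.finrank F V)

/-- The minimal matrix representation of a flag `g`: conditions (i)–(iii) together with
(iv) within each block, entries in the same row as a pivot of the block and strictly to its left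
within the block vanish; (v) within each block, pivot row indices strictly increase. -/
def IsMinRep (g : Set (Submodule F (Fin n → F))) (M : Matrix (Fin n) (Fin n) F) : Prop :=
  IsRep g M ∧
  (∀ r i i' : Fin n, SameBlock g i i' → IsPivot M r i → i' < i → M r i' = 0) ∧
  (∀ r r' i i' : Fin n, SameBlock g i i' → IsPivot M r i → IsPivot M r' i' → i < i' → r < r')

/-- `σ` is the label of the maximal flag `f`: `σ j` is the pivot row of the `j`-th column of
the minimal matrix representation of `f`. -/
def IsLabel (f : Set (Submodule F (Fin n → F))) (σ : Equiv.Perm (Fin n)) : Prop :=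
  ∃ M : Matrix (Fin n) (Fin n) F, IsRep f M ∧ ∀ j : Fin n, IsPivot M (σ j) j

/-- Strict lexicographic order on permutations in one-line notation `(σ 0, …, σ (n-1))`. -/
def LexLt {n : ℕ} (σ τ : Equiv.Perm (Fin n)) : Prop :=
  ∃ j : Fin n, (∀ i : Fin n, i < j → σ i = τ i) ∧ σ j < τ j

/-- `σ` is the lexicographically least label among the labels of maximal flags containing `g`. -/
def IsMinlabel (g : Set (Submodule F (Fin n → F))) (σ : Equiv.Perm (Fin n)) : Prop :=
  (∃ f, IsMaximalFlag f ∧ g ⊆ f ∧ IsLabel f σ) ∧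
  ∀ (f : Set (Submodule F (Fin n → F))) (τ : Equiv.Perm (Fin n)),
    IsMaximalFlag f → g ⊆ f → IsLabel f τ → σ = τ ∨ LexLt σ τ

/-- `t` is a (0-based) ascent of `σ`: `σ t < σ (t+1)`.  (In the 1-based indexing of the paper
this corresponds to the ascent `(σ(t+1), σ(t+2))` at position `t+1`.) -/
def Ascent {n : ℕ} (σ : Equiv.Perm (Fin n)) (t : ℕ) : Prop :=
  ∃ h : t + 1 < n, σ ⟨t, Nat.lt_of_succ_lt h⟩ < σ ⟨t + 1, h⟩

/-- `σ` is the decreasing permutation `σ(j) = n + 1 - j` (in 0-based indexing, `n - 1 - j`). -/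
def IsDecreasing {n : ℕ} (σ : Equiv.Perm (Fin n)) : Prop :=
  ∀ j : Fin n, (σ j : ℕ) = n - 1 - (j : ℕ)

/-- Pivot positions in a fixed column are unique. -/
lemma IsPivot.eq {M : Matrix (Fin n) (Fin n) F} {r r' j : Fin n}
    (h : IsPivot M r j) (h' : IsPivot M r' j) : r = r' := by
  rcases lt_trichotomy r r' with hlt | heq | hlt
  · exact absurd (h.2 _ hlt) h'.1
  · exact heq
  · exact absurd (h'.2 _ hlt) h.1

lemma colSpan_mono (M : Matrix (Fin n) (Fin n) F) : Monotone (colSpan M) := fun _ _ hjk =>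
  Submodule.span_mono (Set.image_mono fun _ hi => lt_of_lt_of_le hi hjk)

lemma col_mem_colSpan (M : Matrix (Fin n) (Fin n) F) {i : Fin n} {j : ℕ} (h : (i : ℕ) < j) :
    Mᵀ i ∈ colSpan M j :=
  Submodule.subset_span ⟨i, h, rfl⟩

lemma colSpan_le {M : Matrix (Fin n) (Fin n) F} {j : ℕ} {W : Submodule F (Fin n → F)}
    (h : ∀ i : Fin n, (i : ℕ) < j → Mᵀ i ∈ W) : colSpan M j ≤ W := by
  refine Submodule.span_le.2 ?_
  rintro _ ⟨i, hi, rfl⟩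
  exact h i hi

lemma finrank_colSpan {M : Matrix (Fin n) (Fin n) F} (hM : colSpan M n = ⊤) {j : ℕ}
    (hj : j ≤ n) : Module.finrank F (colSpan M j) = j := by
  have hli : LinearIndependent F (fun i : Fin n => Mᵀ i) := by
    refine linearIndependent_of_top_le_span_of_card_eq_finrank ?_ (by simp)
    rw [← hM]
    exact Submodule.span_mono (Set.image_subset_range _ _)
  have hli' : LinearIndependent F
      (fun i : {i : Fin n // (i : ℕ) < j} => Mᵀ (i : Fin n)) :=
    hli.comp _ Subtype.val_injective
  have hcard := finrank_span_eq_card hli'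
  have hset : Set.range (fun i : {i : Fin n // (i : ℕ) < j} => Mᵀ (i : Fin n)) =
      (fun i : Fin n => Mᵀ i) '' {i : Fin n | (i : ℕ) < j} := by
    ext v
    simp
  rw [hset] at hcard
  rw [colSpan, hcard, Fintype.card_subtype, Fin.card_filter_val_lt, min_eq_right hj]

/-- The column spans of an invertible matrix form a maximal flag. -/
lemma isMaximalFlag_colSpan (hn : 2 ≤ n) {M : Matrix (Fin n) (Fin n) F}
    (hM : colSpan M n = ⊤) : IsMaximalFlag (colSpan M '' Set.Icc 1 (n - 1)) := by
  refine ⟨⟨(Set.finite_Icc _ _).image _, ⟨_, 1, ⟨le_rfl, by omega⟩, rfl⟩, ?_, ?_⟩, ?_⟩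
  · rintro _ ⟨j, -, rfl⟩ _ ⟨k, -, rfl⟩ -
    exact (le_total j k).imp (fun h => colSpan_mono M h) (fun h => colSpan_mono M h)
  · rintro _ ⟨j, ⟨h1, h2⟩, rfl⟩
    have hj := finrank_colSpan hM (j := j) (by omega)
    constructor <;> intro h <;> rw [h] at hj <;> simp at hj <;> omega
  · intro j h1 h2
    exact ⟨_, ⟨j, ⟨h1, h2⟩, rfl⟩, finrank_colSpan hM (by omega)⟩

lemma IsRep.mono {f g : Set (Submodule F (Fin n → F))} {M : Matrix (Fin n) (Fin n) F}
    (h : IsRep f M) (hgf : g ⊆ f) : IsRep g M :=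
  ⟨fun V hV => h.1 V (hgf hV), h.2⟩

lemma IsLabel.mono {f g : Set (Submodule F (Fin n → F))} {σ : Equiv.Perm (Fin n)}
    (h : IsLabel f σ) (hgf : g ⊆ f) : IsLabel g σ :=
  let ⟨M, hM, hp⟩ := h
  ⟨M, hM.mono hgf, hp⟩

/-- The last nonzero row of a vector in the span of the first `j` columns is the pivot row of
one of these columns. -/
lemma exists_pivot_of_mem_colSpan {M : Matrix (Fin n) (Fin n) F} {σ : Equiv.Perm (Fin n)}
    (hp : ∀ i, IsPivot M (σ i) i) {j : ℕ} {v : Fin n → F} (hv : v ∈ colSpan M j) {r : Fin n}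
    (hr : v r ≠ 0) (hr' : ∀ r', r < r' → v r' = 0) :
    ∃ i : Fin n, (i : ℕ) < j ∧ σ i = r := by
  classical
  obtain ⟨t, ht, c, hc⟩ := (Submodule.mem_span_image_iff_exists_fun F).1 hv
  have hvr (s : Fin n) : v s = ∑ i, c i * M s i := by
    rw [← hc]
    simp [Finset.sum_apply]
  have hne : (Finset.univ.filter fun i => c i ≠ 0).Nonempty := by
    by_contra! h
    refine hr ((hvr r).trans (Finset.sum_eq_zero fun i hi => ?_))
    have := Finset.filter_eq_empty_iff.1 h hi
    simp [not_not.1 this]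
  obtain ⟨i, hi, hmax⟩ := Finset.exists_max_image _ (fun i : t => σ i) hne
  have hmax' : ∀ k, c k ≠ 0 → σ k ≤ σ i := fun k hk => hmax k (by simpa using hk)
  have hi : c i ≠ 0 := by simpa using hi
  have hzero : ∀ s, σ i < s → v s = 0 := fun s hs => by
    refine (hvr s).trans (Finset.sum_eq_zero fun k _ => ?_)
    by_cases hk : c k = 0
    · simp [hk]
    · rw [(hp k).2 s ((hmax' k hk).trans_lt hs), mul_zero]
  have hpiv : v (σ i) ≠ 0 := by
    rw [hvr, Finset.sum_eq_single i]
    · exact mul_ne_zero hi (hp i).1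
    · intro k _ hki
      by_cases hk : c k = 0
      · simp [hk]
      · have : σ k ≠ σ i := fun h => hki (Subtype.ext (σ.injective h))
        rw [(hp k).2 _ (lt_of_le_of_ne (hmax' k hk) this), mul_zero]
    · simp
  refine ⟨i, ht i.2, ?_⟩
  rcases lt_trichotomy (σ i) r with h | h | h
  · exact absurd (hzero _ h) hr
  · exact h
  · exact absurd (hr' _ h) hpiv

/-- A maximal flag has at most one label. -/
lemma IsLabel.unique {f : Set (Submodule F (Fin n → F))} (hf : IsMaximalFlag f)
    {σ τ : Equiv.Perm (Fin n)} (hσ : IsLabel f σ) (hτ : IsLabel f τ) : σ = τ := by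
  obtain ⟨M, hM, hMp⟩ := hσ
  obtain ⟨N, hN, hNp⟩ := hτ
  have hspan (j : ℕ) (h1 : 1 ≤ j) (h2 : j ≤ n) : colSpan N j = colSpan M j := by
    rcases h2.eq_or_lt with rfl | h2
    · rw [hN.2.1, hM.2.1]
    · obtain ⟨V, hV, rfl⟩ := hf.2 j h1 (by omega)
      rw [hN.1 V hV, hM.1 V hV]
  ext1 j
  induction j using WellFoundedLT.induction with
  | ind j ih =>
    have hmem : Nᵀ j ∈ colSpan M (j + 1) := by
      rw [← hspan _ (by omega) (by omega)]
      exact col_mem_colSpan N (Nat.lt_succ_self _)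
    obtain ⟨i, hij, hi⟩ := exists_pivot_of_mem_colSpan hMp hmem (hNp j).1 (hNp j).2
    rcases (Nat.lt_succ_iff.1 hij).eq_or_lt with h | h
    · rwa [← Fin.ext h] at hi ⊢
    · have := τ.injective ((ih i h).symm.trans hi)
      exact absurd h (by simp [this])

/-- Swap the columns `a` and `b` of `M`, and clear the entry in row `r` of the new column `b`
using the new column `a`. -/
def swapCols (M : Matrix (Fin n) (Fin n) F) (a b r : Fin n) : Matrix (Fin n) (Fin n) F :=
  fun s j => if j = b then M s a - M r a * M s b else if j = a then M s b else M s j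

lemma colSpan_swapCols (M : Matrix (Fin n) (Fin n) F) {a b : Fin n} (hab : (b : ℕ) = a + 1)
    (r : Fin n) {j : ℕ} (hj : j ≠ b) : colSpan (swapCols M a b r) j = colSpan M j := by
  have hne : a ≠ b := fun h => by simp [h] at hab
  have hb : (swapCols M a b r)ᵀ b = Mᵀ a - M r a • Mᵀ b := by
    ext s; simp [swapCols]
  have ha : (swapCols M a b r)ᵀ a = Mᵀ b := by
    ext s; simp [swapCols, hne]
  have ho (i : Fin n) (h1 : i ≠ b) (h2 : i ≠ a) : (swapCols M a b r)ᵀ i = Mᵀ i := by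
    ext s; simp [swapCols, h1, h2]
  apply le_antisymm <;> refine colSpan_le fun i hi => ?_
  · by_cases h1 : i = b
    · subst h1
      rw [hb]
      exact sub_mem (col_mem_colSpan M (by omega))
        (Submodule.smul_mem _ _ (col_mem_colSpan M hi))
    by_cases h2 : i = a
    · subst h2
      rw [ha]
      exact col_mem_colSpan M (by omega)
    rw [ho i h1 h2]
    exact col_mem_colSpan M hi
  · by_cases h1 : i = b
    · subst h1
      rw [← ha]
      exact col_mem_colSpan _ (by omega)
    by_cases h2 : i = a
    · subst h2
      rw [← sub_add_cancel (Mᵀ i) (M r i • Mᵀ b), ← hb, ← ha]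
      exact add_mem (col_mem_colSpan _ (by omega))
        (Submodule.smul_mem _ _ (col_mem_colSpan _ hi))
    rw [← ho i h1 h2]
    exact col_mem_colSpan _ hi

/-- If a flag with no member of dimension `a + 1` has a matrix representation whose pivots are
given by `σ`, and `σ` has a descent at `a`, then the flag extends to a maximal flag labelled by
`σ` with its values at `a` and `a + 1` swapped. -/
lemma exists_isMaximalFlag_swap (hn : 2 ≤ n) {g : Set (Submodule F (Fin n → F))}
    (hg : IsFlag g) {σ : Equiv.Perm (Fin n)} (hσ : IsLabel g σ) {a b : Fin n}
    (hab : (b : ℕ) = a + 1) (hdesc : σ b < σ a) (hdim : ∀ V ∈ g, Module.finrank F V ≠ b) :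
    ∃ f, IsMaximalFlag f ∧ g ⊆ f ∧ IsLabel f ((Equiv.swap a b).trans σ) := by
  obtain ⟨M, ⟨hMg, hMn, hM1, hM0⟩, hMp⟩ := hσ
  have hne : a ≠ b := fun h => by simp [h] at hab
  set N := swapCols M a b (σ b) with hN
  have hNn : colSpan N n = ⊤ := by
    rw [hN, colSpan_swapCols M hab _ (by omega), hMn]
  have hNb (s : Fin n) : N s b = M s a - M (σ b) a * M s b := by simp [hN, swapCols]
  have hNa (s : Fin n) : N s a = M s b := by simp [hN, swapCols, hne]
  have hNo (s i : Fin n) (h1 : i ≠ b) (h2 : i ≠ a) : N s i = M s i := by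
    simp [hN, swapCols, h1, h2]
  set τ : Equiv.Perm (Fin n) := (Equiv.swap a b).trans σ with hτ
  have hτb : τ b = σ a := by simp [hτ]
  have hτa : τ a = σ b := by simp [hτ]
  have hτo (i : Fin n) (h1 : i ≠ b) (h2 : i ≠ a) : τ i = σ i := by
    simp [hτ, Equiv.swap_apply_of_ne_of_ne h2 h1]
  have hone (j : Fin n) : N (τ j) j = 1 := by
    by_cases h1 : j = b
    · rw [h1, hτb, hNb, (hMp b).2 _ hdesc, hM1 _ _ (hMp a), mul_zero, sub_zero]
    by_cases h2 : j = a
    · rw [h2, hτa, hNa, hM1 _ _ (hMp b)]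
    rw [hτo j h1 h2, hNo _ _ h1 h2, hM1 _ _ (hMp j)]
  have hNp (j : Fin n) : IsPivot N (τ j) j := by
    refine ⟨by simp [hone], fun s hs => ?_⟩
    by_cases h1 : j = b
    · rw [h1, hτb] at hs
      rw [h1, hNb, (hMp a).2 _ hs, (hMp b).2 _ (hdesc.trans hs), mul_zero, sub_zero]
    by_cases h2 : j = a
    · rw [h2, hτa] at hs
      rw [h2, hNa, (hMp b).2 _ hs]
    rw [hτo j h1 h2] at hs
    rw [hNo _ _ h1 h2, (hMp j).2 _ hs]
  have hN0 (j k : Fin n) (hjk : j < k) : N (τ j) k = 0 := by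
    have hM0' (i l : Fin n) (h : (i : ℕ) < l) : M (σ i) l = 0 := hM0 _ _ _ (hMp i) h
    have hjk' : (j : ℕ) < k := hjk
    by_cases h1 : j = b
    · subst h1
      rw [hτb, hNo _ _ hjk.ne' (by rintro rfl; omega), hM0' _ _ (by omega)]
    by_cases h2 : j = a
    · subst h2
      rw [hτa]
      by_cases h3 : k = b
      · rw [h3, hNb, hM1 _ _ (hMp b), mul_one, sub_self]
      · have : (k : ℕ) ≠ b := fun h => h3 (Fin.ext h)
        rw [hNo _ _ h3 hjk.ne', hM0' _ _ (by omega)]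
    rw [hτo j h1 h2]
    have hja : (j : ℕ) ≠ a := fun h => h2 (Fin.ext h)
    by_cases h3 : k = b
    · subst h3
      rw [hNb, hM0' _ _ hjk, hM0' j a (by omega), mul_zero, sub_zero]
    by_cases h4 : k = a
    · subst h4
      rw [hNa, hM0' _ _ (by omega)]
    rw [hNo _ _ h3 h4, hM0' _ _ hjk]
  refine ⟨_, isMaximalFlag_colSpan hn hNn, fun V hV => ?_, N, ⟨?_, hNn, ?_, ?_⟩, hNp⟩
  · refine ⟨Module.finrank F V, ⟨?_, ?_⟩, ?_⟩
    · exact Submodule.one_le_finrank_iff.2 (hg.2.2.2 V hV).1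
    · have := Submodule.finrank_lt (hg.2.2.2 V hV).2
      rw [Module.finrank_fin_fun] at this
      omega
    · rw [hN, colSpan_swapCols M hab _ (hdim V hV), hMg V hV]
  · rintro _ ⟨j, ⟨-, hj⟩, rfl⟩
    rw [finrank_colSpan hNn (by omega)]
  · intro r j hr
    rw [hr.eq (hNp j), hone]
  · intro r j k hr hjk
    rw [hr.eq (hNp j), hN0 j k hjk]

/-- for the decreasing permutation `σ`, a flag lies in `X_σ` iff it is a
maximal flag with label `σ`. -/
theorem X_of_maximal_label_consists_of_maximal_flags
    [Fintype F] (hn : 2 ≤ n)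
    (σ : Equiv.Perm (Fin n)) (hσ : IsDecreasing σ)
    (g : Set (Submodule F (Fin n → F))) (hg : IsFlag g) :
    IsMinlabel g σ ↔ IsMaximalFlag g ∧ IsLabel g σ := by
  constructor
  · rintro ⟨⟨f, -, hgf, hlabel⟩, hmin⟩
    have hgσ := hlabel.mono hgf
    refine ⟨⟨hg, fun d hd1 hd2 => ?_⟩, hgσ⟩
    by_contra! hdim
    obtain ⟨a, ha⟩ : ∃ a : Fin n, (a : ℕ) = d - 1 := ⟨⟨d - 1, by omega⟩, rfl⟩
    obtain ⟨b, hb⟩ : ∃ b : Fin n, (b : ℕ) = d := ⟨⟨d, by omega⟩, rfl⟩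
    have hab : a < b := Fin.lt_def.2 (by omega)
    have hdesc : σ b < σ a := by
      rw [Fin.lt_def, hσ, hσ]
      omega
    obtain ⟨f', hf', hgf', hl'⟩ := exists_isMaximalFlag_swap hn hg hgσ (by omega) hdesc
      (fun V hV => by rw [hb]; exact hdim V hV)
    rcases hmin f' _ hf' hgf' hl' with h | ⟨j, hlt, hj⟩
    · have := congrArg (fun π : Equiv.Perm (Fin n) => π a) h
      simp only [Equiv.trans_apply, Equiv.swap_apply_left] at this
      exact hdesc.ne' this
    · by_cases hjb : j = b
      · have := hlt a (hjb ▸ hab)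
        simp only [Equiv.trans_apply, Equiv.swap_apply_left] at this
        exact hdesc.ne' this
      by_cases hja : j = a
      · subst hja
        simp only [Equiv.trans_apply, Equiv.swap_apply_left] at hj
        exact lt_asymm hj hdesc
      · simp [Equiv.swap_apply_of_ne_of_ne hja hjb] at hj
  · rintro ⟨hmax, hlabel⟩
    exact ⟨⟨g, hmax, subset_rfl, hlabel⟩, fun f τ _ hgf hτ =>
      Or.inl (hlabel.unique hmax (hτ.mono hgf))⟩
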